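/- arXiv:0901.1807 — 3 statements merged into one kernel-verified Lean document; each statement's English description precedes it below -/
import Mathlib

section
/- Let α ≥ 2 and set φ₀(k) := |k|^α k. Let k₁, k₂ be nonzero integers with k := k₁ + k₂ ≠ 0, let η₁, η₂ ∈ ℤ² with η := η₁ + η₂, and let τ₁, τ₂ ∈ ℝ with τ := τ₁ + τ₂. Define σ := τ − |k|^α k + |η|²/k, σ₁ := τ₁ − |k₁|^α k₁ + |η₁|²/k₁, σ₂ := τ₂ − |k₂|^α k₂ + |η₂|²/k₂. Then the resonance identity σ₁ + σ₂ − σ = (|k|^α k − |k₁|^α k₁ − |k₂|^α k₂) + |kη₁ − k₁η|²/(k·k₁·k₂) holds. -/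
noncomputable section

/-- Squared Euclidean norm of `η ∈ ℤ²` (as a real number). -/
def nsq (η : ℤ × ℤ) : ℝ := (η.1 : ℝ) ^ 2 + (η.2 : ℝ) ^ 2

/-- The dispersion `φ₀(k) = |k|^α k` of the dispersion generalised KP-II equation. -/
def phiA (α : ℝ) (k : ℤ) : ℝ := |(k : ℝ)| ^ α * (k : ℝ)

/-- The modulation `σ(k,η,τ) = τ − |k|^α k + |η|²/k` of the dispersion generalised
KP-II equation. -/
def sigA (α : ℝ) (k : ℤ) (η : ℤ × ℤ) (τ : ℝ) : ℝ :=
  τ - phiA α k + nsq η / (k : ℝ)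

/-- The resonance identity (3.7) of the paper:
`σ₁ + σ₂ − σ = (|k|^α k − |k₁|^α k₁ − |k₂|^α k₂) + |kη₁ − k₁η|²/(k·k₁·k₂)`
where `k = k₁ + k₂`, `η = η₁ + η₂`, `τ = τ₁ + τ₂`. -/
theorem kp_resonance_identity_dispersive (α : ℝ) (hα : 2 ≤ α)
    (k₁ k₂ : ℤ) (hk₁ : k₁ ≠ 0) (hk₂ : k₂ ≠ 0) (hk : k₁ + k₂ ≠ 0)
    (η₁ η₂ : ℤ × ℤ) (τ₁ τ₂ : ℝ) :
    sigA α k₁ η₁ τ₁ + sigA α k₂ η₂ τ₂ - sigA α (k₁ + k₂) (η₁ + η₂) (τ₁ + τ₂)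
      = (phiA α (k₁ + k₂) - phiA α k₁ - phiA α k₂)
        + nsq ((k₁ + k₂) * η₁.1 - k₁ * (η₁.1 + η₂.1),
               (k₁ + k₂) * η₁.2 - k₁ * (η₁.2 + η₂.2))
          / (((k₁ + k₂ : ℤ) : ℝ) * (k₁ : ℝ) * (k₂ : ℝ)) := by
  have h₁ : (k₁ : ℝ) ≠ 0 := by exact_mod_cast hk₁
  have h₂ : (k₂ : ℝ) ≠ 0 := by exact_mod_cast hk₂
  have h : (k₁ : ℝ) + k₂ ≠ 0 := by exact_mod_cast hk
  simp only [sigA, nsq, Prod.fst_add, Prod.snd_add]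
  push_cast
  field_simp
  ring
end
end

section
/- Let α ≥ 2. There exists a constant c > 0, depending only on α, such that for all nonzero integers k₁, k₂ with k := k₁ + k₂ ≠ 0, all η₁, η₂ ∈ ℤ² with η := η₁ + η₂, and all τ₁, τ₂ ∈ ℝ with τ := τ₁ + τ₂, the modulations σ := τ − |k|^α k + |η|²/k, σⱼ := τⱼ − |kⱼ|^α kⱼ + |ηⱼ|²/kⱼ (j = 1,2) satisfy max{|σ|, |σ₁|, |σ₂|} ≥ c ( |k_min| |k_max|^α + |kη₁ − k₁η|²/|k k₁ k₂| ), where |k_min| := min(|k|,|k₁|,|k₂|) and |k_max| := max(|k|,|k₁|,|k₂|). In particular, the two terms |k|^α k − |k₁|^α k₁ − |k₂|^α k₂ and |kη₁ − k₁η|²/(k k₁ k₂) on the right-hand side of the resonance identity σ₁ + σ₂ − σ = (|k|^α k − |k₁|^α k₁ − |k₂|^α k₂) + |kη₁ − k₁η|²/(k k₁ k₂) have the same sign. -/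
noncomputable section

/-- Superadditivity of `t ↦ t ^ (α + 1)` on positive reals, in quantitative form. -/
theorem min_mul_rpow_add_le {α a b : ℝ} (hα : 2 ≤ α) (ha : 0 < a) (hb : 0 < b) :
    3 / 4 * (min a b * (a + b) ^ α) ≤
      (a + b) ^ α * (a + b) - a ^ α * a - b ^ α * b := by
  wlog hab : a ≤ b generalizing a b
  · have h := this hb ha (le_of_not_ge hab)
    rw [min_comm, add_comm b a] at h
    linarith
  have hquarter : a ^ α ≤ (a + b) ^ α / 4 := by
    have hhalf : a ^ α ≤ ((a + b) * (1 / 2)) ^ α :=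
      Real.rpow_le_rpow ha.le (by linarith) (by linarith)
    have hpow : (1 / 2 : ℝ) ^ α ≤ 1 / 4 := by
      have h := Real.rpow_le_rpow_of_exponent_ge (x := (1 / 2 : ℝ))
        (by norm_num) (by norm_num) hα
      norm_num at h ⊢
      exact h
    rw [Real.mul_rpow (by positivity) (by norm_num)] at hhalf
    have hs : 0 ≤ (a + b) ^ α := by positivity
    nlinarith
  have hmono : b ^ α ≤ (a + b) ^ α :=
    Real.rpow_le_rpow hb.le (by linarith) (by linarith)
  rw [min_eq_left hab]
  nlinarith

/-- The dispersive resonance function has the sign of `x y (x + y)` and is bounded below. -/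
theorem dispersive_resonance {α x y : ℝ} (hα : 2 ≤ α) (hx : x ≠ 0) (hy : y ≠ 0)
    (hxy : x + y ≠ 0) :
    (0 < (x + y) * x * y ∧
      3 / 4 * (min |x + y| (min |x| |y|) * max |x + y| (max |x| |y|) ^ α) ≤
        |x + y| ^ α * (x + y) - |x| ^ α * x - |y| ^ α * y) ∨
    ((x + y) * x * y < 0 ∧
      3 / 4 * (min |x + y| (min |x| |y|) * max |x + y| (max |x| |y|) ^ α) ≤
        -(|x + y| ^ α * (x + y) - |x| ^ α * x - |y| ^ α * y)) := by
  have key : ∀ a b s : ℝ, 0 < a → 0 < b → s = a + b → ∀ m M : ℝ, m = min a b → M = s →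
      3 / 4 * (m * M ^ α) ≤ s ^ α * s - a ^ α * a - b ^ α * b := by
    rintro a b s ha hb rfl m M rfl rfl
    exact min_mul_rpow_add_le hα ha hb
  rcases lt_or_gt_of_ne hx with hx | hx <;> rcases lt_or_gt_of_ne hy with hy | hy <;>
    rcases lt_or_gt_of_ne hxy with hs | hs
  · right
    rw [abs_of_neg hx, abs_of_neg hy, abs_of_neg hs]
    refine ⟨mul_neg_of_pos_of_neg (mul_pos_of_neg_of_neg hs hx) hy, ?_⟩
    have h := key (-x) (-y) (-(x + y)) (by linarith) (by linarith) (by ring)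
      (min (-(x + y)) (min (-x) (-y))) (max (-(x + y)) (max (-x) (-y))) (by grind) (by grind)
    linarith
  · linarith
  · left
    rw [abs_of_neg hx, abs_of_pos hy, abs_of_neg hs]
    refine ⟨mul_pos (mul_pos_of_neg_of_neg hs hx) hy, ?_⟩
    have h := key (-(x + y)) y (-x) (by linarith) (by linarith) (by ring)
      (min (-(x + y)) (min (-x) y)) (max (-(x + y)) (max (-x) y)) (by grind) (by grind)
    linarith
  · right
    rw [abs_of_neg hx, abs_of_pos hy, abs_of_pos hs]
    refine ⟨mul_neg_of_neg_of_pos (mul_neg_of_pos_of_neg hs hx) hy, ?_⟩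
    have h := key (x + y) (-x) y (by linarith) (by linarith) (by ring)
      (min (x + y) (min (-x) y)) (max (x + y) (max (-x) y)) (by grind) (by grind)
    linarith
  · left
    rw [abs_of_pos hx, abs_of_neg hy, abs_of_neg hs]
    refine ⟨mul_pos_of_neg_of_neg (mul_neg_of_neg_of_pos hs hx) hy, ?_⟩
    have h := key (-(x + y)) x (-y) (by linarith) (by linarith) (by ring)
      (min (-(x + y)) (min x (-y))) (max (-(x + y)) (max x (-y))) (by grind) (by grind)
    linarith
  · right
    rw [abs_of_pos hx, abs_of_neg hy, abs_of_pos hs]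
    refine ⟨mul_neg_of_pos_of_neg (mul_pos hs hx) hy, ?_⟩
    have h := key (x + y) (-y) x (by linarith) (by linarith) (by ring)
      (min (x + y) (min x (-y))) (max (x + y) (max x (-y))) (by grind) (by grind)
    linarith
  · linarith
  · left
    rw [abs_of_pos hx, abs_of_pos hy, abs_of_pos hs]
    refine ⟨mul_pos (mul_pos hs hx) hy, ?_⟩
    exact key x y (x + y) hx hy rfl _ _ (by grind) (by grind)

theorem nsq_nonneg (η : ℤ × ℤ) : 0 ≤ nsq η := by
  unfold nsq
  positivity

/-- The resonance identity for the modulations. -/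
theorem sigA_resonance (α : ℝ) {k₁ k₂ : ℤ} (hk₁ : k₁ ≠ 0) (hk₂ : k₂ ≠ 0) (hk : k₁ + k₂ ≠ 0)
    (η₁ η₂ : ℤ × ℤ) (τ₁ τ₂ : ℝ) :
    sigA α k₁ η₁ τ₁ + sigA α k₂ η₂ τ₂ - sigA α (k₁ + k₂) (η₁ + η₂) (τ₁ + τ₂) =
      phiA α (k₁ + k₂) - phiA α k₁ - phiA α k₂ +
        nsq ((k₁ + k₂) * η₁.1 - k₁ * (η₁.1 + η₂.1), (k₁ + k₂) * η₁.2 - k₁ * (η₁.2 + η₂.2)) /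
          (((k₁ + k₂ : ℤ) : ℝ) * (k₁ : ℝ) * (k₂ : ℝ)) := by
  have h₁ : (k₁ : ℝ) ≠ 0 := mod_cast hk₁
  have h₂ : (k₂ : ℝ) ≠ 0 := mod_cast hk₂
  have h : (k₁ : ℝ) + k₂ ≠ 0 := mod_cast hk
  simp only [sigA, nsq, Prod.fst_add, Prod.snd_add]
  push_cast
  field_simp
  ring

/-- The resonance estimate (3.8) of the paper: there is `c > 0`, depending only on
`α ≥ 2`, with `max{|σ|,|σ₁|,|σ₂|} ≥ c (|k_min||k_max|^α + |kη₁ − k₁η|²/|k k₁ k₂|)`;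
moreover the two terms on the right of the resonance identity have the same sign. -/
theorem kp_resonance_estimate (α : ℝ) (hα : 2 ≤ α) :
    ∃ c : ℝ, 0 < c ∧
      ∀ (k₁ k₂ : ℤ), k₁ ≠ 0 → k₂ ≠ 0 → k₁ + k₂ ≠ 0 →
      ∀ (η₁ η₂ : ℤ × ℤ) (τ₁ τ₂ : ℝ),
      c * (min |((k₁ + k₂ : ℤ) : ℝ)| (min |(k₁ : ℝ)| |(k₂ : ℝ)|)
            * max |((k₁ + k₂ : ℤ) : ℝ)| (max |(k₁ : ℝ)| |(k₂ : ℝ)|) ^ α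
          + nsq ((k₁ + k₂) * η₁.1 - k₁ * (η₁.1 + η₂.1),
                 (k₁ + k₂) * η₁.2 - k₁ * (η₁.2 + η₂.2))
            / |((k₁ + k₂ : ℤ) : ℝ) * (k₁ : ℝ) * (k₂ : ℝ)|)
        ≤ max |sigA α (k₁ + k₂) (η₁ + η₂) (τ₁ + τ₂)|
            (max |sigA α k₁ η₁ τ₁| |sigA α k₂ η₂ τ₂|) ∧
      0 ≤ (phiA α (k₁ + k₂) - phiA α k₁ - phiA α k₂)
          * (nsq ((k₁ + k₂) * η₁.1 - k₁ * (η₁.1 + η₂.1),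
                  (k₁ + k₂) * η₁.2 - k₁ * (η₁.2 + η₂.2))
             / (((k₁ + k₂ : ℤ) : ℝ) * (k₁ : ℝ) * (k₂ : ℝ))) := by
  refine ⟨1 / 4, by norm_num, fun k₁ k₂ hk₁ hk₂ hk η₁ η₂ τ₁ τ₂ ↦ ?_⟩
  have hid := sigA_resonance α hk₁ hk₂ hk η₁ η₂ τ₁ τ₂
  have hN := nsq_nonneg
    ((k₁ + k₂) * η₁.1 - k₁ * (η₁.1 + η₂.1), (k₁ + k₂) * η₁.2 - k₁ * (η₁.2 + η₂.2))
  have hD := dispersive_resonance (x := k₁) (y := k₂) hα (mod_cast hk₁) (mod_cast hk₂)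
    (mod_cast hk)
  rw [← Int.cast_add] at hD
  change (_ ∧ _ ≤ phiA α (k₁ + k₂) - phiA α k₁ - phiA α k₂) ∨
    (_ ∧ _ ≤ -(phiA α (k₁ + k₂) - phiA α k₁ - phiA α k₂)) at hD
  have hB : 0 ≤ min |((k₁ + k₂ : ℤ) : ℝ)| (min |(k₁ : ℝ)| |(k₂ : ℝ)|) *
      max |((k₁ + k₂ : ℤ) : ℝ)| (max |(k₁ : ℝ)| |(k₂ : ℝ)|) ^ α := by positivity
  generalize nsq
    ((k₁ + k₂) * η₁.1 - k₁ * (η₁.1 + η₂.1), (k₁ + k₂) * η₁.2 - k₁ * (η₁.2 + η₂.2)) = N at *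
  generalize ((k₁ + k₂ : ℤ) : ℝ) * (k₁ : ℝ) * (k₂ : ℝ) = P at *
  generalize min |((k₁ + k₂ : ℤ) : ℝ)| (min |(k₁ : ℝ)| |(k₂ : ℝ)|) *
      max |((k₁ + k₂ : ℤ) : ℝ)| (max |(k₁ : ℝ)| |(k₂ : ℝ)|) ^ α = B at *
  generalize phiA α (k₁ + k₂) - phiA α k₁ - phiA α k₂ = D at *
  generalize sigA α (k₁ + k₂) (η₁ + η₂) (τ₁ + τ₂) = σ at *
  generalize sigA α k₁ η₁ τ₁ = σ₁ at *
  generalize sigA α k₂ η₂ τ₂ = σ₂ at *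
  have hmax : |D + N / P| ≤ 3 * max |σ| (max |σ₁| |σ₂|) := by
    have h : |σ| ≤ max |σ| (max |σ₁| |σ₂|) := le_max_left _ _
    have h₁ : |σ₁| ≤ max |σ| (max |σ₁| |σ₂|) := (le_max_left _ _).trans (le_max_right _ _)
    have h₂ : |σ₂| ≤ max |σ| (max |σ₁| |σ₂|) := (le_max_right _ _).trans (le_max_right _ _)
    rw [← hid]
    linarith [abs_sub (σ₁ + σ₂) σ, abs_add_le σ₁ σ₂]
  rcases hD with ⟨hP, hD⟩ | ⟨hP, hD⟩
  · have hNP : 0 ≤ N / P := div_nonneg hN hP.le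
    rw [abs_of_pos hP]
    exact ⟨by linarith [le_abs_self (D + N / P)], mul_nonneg (by linarith) hNP⟩
  · have hNP : N / P ≤ 0 := div_nonpos_of_nonneg_of_nonpos hN hP.le
    rw [abs_of_neg hP, div_neg]
    exact ⟨by linarith [neg_abs_le (D + N / P)], mul_nonneg_of_nonpos_of_nonpos (by linarith) hNP⟩
end
end

section
/- Let b > 1/2. There is a constant C, depending only on b, such that for every a ∈ ℝ and all nonzero integers k₁, k₂ with k := k₁ + k₂ ≠ 0, one has Σ_{r=0}^{∞} ⟨a + (k/(k₁k₂)) r⟩^{−2b} ≤ C |k₁k₂|/|k|. -/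
open ENNReal

noncomputable section

/-- Japanese bracket `⟨x⟩ = (1+x²)^(1/2)` on `ℝ`. -/
def jap (x : ℝ) : ℝ := Real.sqrt (1 + x ^ 2)

open MeasureTheory in
theorem integrable_jap_rpow {b : ℝ} (hb : 1 / 2 < b) :
    Integrable fun x : ℝ => jap x ^ (-(2 * b)) := by
  have h := integrable_rpow_neg_one_add_norm_sq (E := ℝ) (μ := volume) (r := 2 * b)
    (by rw [Module.finrank_self]; push_cast; linarith)
  refine h.congr (.of_forall fun x => ?_)
  simp only [jap, Real.sqrt_eq_rpow, Real.norm_eq_abs, sq_abs]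
  rw [← Real.rpow_mul (by positivity)]
  congr 1
  ring

theorem jap_pos (x : ℝ) : 0 < jap x := Real.sqrt_pos.2 (by positivity)

theorem jap_add_le {t : ℝ} (ht : |t| ≤ 2) (x : ℝ) : jap (x + t) ≤ 3 * jap x := by
  have h2 : t ^ 2 ≤ 4 := by nlinarith [sq_abs t, abs_nonneg t]
  refine Real.sqrt_le_iff.2 ⟨by linarith [jap_pos x], ?_⟩
  rw [mul_pow, jap, Real.sq_sqrt (by positivity)]
  nlinarith [sq_nonneg (x - t), sq_nonneg x]

theorem jap_rpow_neg_le {s : ℝ} (hs : 0 ≤ s) {t : ℝ} (ht : |t| ≤ 2) (x : ℝ) :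
    jap x ^ (-s) ≤ 3 ^ s * jap (x + t) ^ (-s) := by
  have h := Real.rpow_le_rpow_of_nonpos (jap_pos (x + t)) (jap_add_le ht x) (neg_nonpos.2 hs)
  rw [Real.mul_rpow (by norm_num) (jap_pos x).le, Real.rpow_neg (by norm_num)] at h
  have h3 : (0 : ℝ) < 3 ^ s := by positivity
  rwa [inv_mul_le_iff₀ h3] at h

open MeasureTheory in
/-- Comparison of a sum over an arithmetic progression with step at most `2` with the integral. -/
theorem tsum_jap_rpow_le {b : ℝ} (hb : 1 / 2 < b) (a : ℝ) {c : ℝ} (hc : c ≠ 0) (hc2 : |c| ≤ 2) :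
    ∑' r : ℕ, ENNReal.ofReal (jap (a + c * r) ^ (-(2 * b))) ≤
      ENNReal.ofReal ((3 ^ (2 * b) * ∫ x, jap x ^ (-(2 * b))) * |c|⁻¹) := by
  set g : ℝ → ℝ := fun s => 3 ^ (2 * b) * jap (a + c * s) ^ (-(2 * b)) with hg
  have hg_int : Integrable g :=
    (((integrable_jap_rpow hb).comp_add_left a).comp_mul_left' hc).const_mul _
  have hg_nonneg : ∀ s, 0 ≤ g s := fun s =>
    mul_nonneg (by positivity) (Real.rpow_nonneg (jap_pos _).le _)
  have hg_eq : ∫ s, g s = (3 ^ (2 * b) * ∫ x, jap x ^ (-(2 * b))) * |c|⁻¹ := by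
    rw [hg, integral_const_mul,
      Measure.integral_comp_mul_left (fun y => jap (a + y) ^ (-(2 * b))) c,
      integral_add_left_eq_self (fun y => jap y ^ (-(2 * b))) a, abs_inv, smul_eq_mul]
    ring
  have hterm : ∀ r : ℕ, ENNReal.ofReal (jap (a + c * r) ^ (-(2 * b))) ≤
      ∫⁻ s in Set.Ico (r : ℝ) (r + 1), ENNReal.ofReal (g s) := fun r => by
    calc ENNReal.ofReal (jap (a + c * r) ^ (-(2 * b)))
        = ∫⁻ _ in Set.Ico (r : ℝ) (r + 1), ENNReal.ofReal (jap (a + c * r) ^ (-(2 * b))) := by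
          simp
      _ ≤ _ := by
          refine setLIntegral_mono' measurableSet_Ico fun s hs => ENNReal.ofReal_le_ofReal ?_
          have ht : |c * (s - r)| ≤ 2 := by
            rw [abs_mul, abs_of_nonneg (sub_nonneg.2 hs.1)]
            nlinarith [abs_nonneg c, hs.1, hs.2]
          convert jap_rpow_neg_le (by linarith : 0 ≤ 2 * b) ht (a + c * r) using 4
          ring
  have hdisj : Pairwise (Function.onFun Disjoint fun r : ℕ => Set.Ico (r : ℝ) (r + 1)) := by
    simpa using (Nat.mono_cast (α := ℝ)).pairwise_disjoint_on_Ico_succ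
  calc _ ≤ ∑' r : ℕ, ∫⁻ s in Set.Ico (r : ℝ) (r + 1), ENNReal.ofReal (g s) :=
        ENNReal.tsum_le_tsum hterm
    _ = ∫⁻ s in ⋃ r : ℕ, Set.Ico (r : ℝ) (r + 1), ENNReal.ofReal (g s) :=
        (lintegral_iUnion (fun _ => measurableSet_Ico) hdisj _).symm
    _ ≤ ∫⁻ s, ENNReal.ofReal (g s) := setLIntegral_le_lintegral _ _
    _ = _ := by
        rw [← ofReal_integral_eq_lintegral_ofReal hg_int (.of_forall hg_nonneg), hg_eq]

theorem abs_add_div_mul_le_two {k₁ k₂ : ℤ} (h₁ : k₁ ≠ 0) (h₂ : k₂ ≠ 0) :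
    |((k₁ + k₂ : ℤ) : ℝ) / ((k₁ : ℝ) * (k₂ : ℝ))| ≤ 2 := by
  have h₁' : (1 : ℝ) ≤ |(k₁ : ℝ)| := mod_cast Int.one_le_abs h₁
  have h₂' : (1 : ℝ) ≤ |(k₂ : ℝ)| := mod_cast Int.one_le_abs h₂
  rw [abs_div, abs_mul, div_le_iff₀ (by positivity)]
  push_cast
  nlinarith [abs_add_le (k₁ : ℝ) k₂]

/-- The elementary summation estimate used in the proof of (2.10):
for `b > 1/2` there is a constant `C`, depending only on `b`, such that for every
`a ∈ ℝ` and all nonzero integers `k₁, k₂` with `k = k₁ + k₂ ≠ 0`,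
`Σ_{r≥0} ⟨a + (k/(k₁k₂)) r⟩^{−2b} ≤ C |k₁k₂|/|k|`. -/
theorem modulation_sum_estimate (b : ℝ) (hb : 1 / 2 < b) :
    ∃ C : ℝ, ∀ (a : ℝ) (k₁ k₂ : ℤ), k₁ ≠ 0 → k₂ ≠ 0 → k₁ + k₂ ≠ 0 →
      (∑' r : ℕ,
          ENNReal.ofReal
            (jap (a + (((k₁ + k₂ : ℤ) : ℝ) / ((k₁ : ℝ) * (k₂ : ℝ))) * (r : ℝ))
              ^ (-(2 * b))))
        ≤ ENNReal.ofReal (C * (|(k₁ : ℝ) * (k₂ : ℝ)| / |((k₁ + k₂ : ℤ) : ℝ)|)) := by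
  refine ⟨3 ^ (2 * b) * ∫ x, jap x ^ (-(2 * b)), fun a k₁ k₂ h₁ h₂ h => ?_⟩
  have hc : ((k₁ + k₂ : ℤ) : ℝ) / ((k₁ : ℝ) * (k₂ : ℝ)) ≠ 0 :=
    div_ne_zero (mod_cast h) (mul_ne_zero (mod_cast h₁) (mod_cast h₂))
  have key := tsum_jap_rpow_le hb a hc (abs_add_div_mul_le_two h₁ h₂)
  rwa [abs_div, inv_div] at key
end
end
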